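/- Let 1 < α ≤ 2 and x > 0. Define the extremal Lévy stable density by its convergent series L_α^{α-2}(x) := (1/(πx)) · ∑_{n=1}^∞ (-x)^n · (Γ(1+n/α)/n!) · sin((nπ/(2α))((α-2)-α)) = -(1/(πx)) ∑_{n=1}^∞ (-x)^n Γ(1+n/α) sin(nπ/α)/n!. Then L_α^{α-2}(x) = (1/x)·F_{1/α}(x) = (1/α)·M_{1/α}(x). -/

import Mathlib

open scoped Real

/-- The Wright function `W_{λ,μ}(x) = ∑ xⁿ/(n!·Γ(λn+μ))` for real parameters and
real argument, with the convention `1/Γ(w) = 0` at poles of `Γ`. -/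
noncomputable def wright (l μ x : ℝ) : ℝ :=
  ∑' n : ℕ, x ^ n / ((n.factorial : ℝ) * Real.Gamma (l * n + μ))

/-- The Mainardi function `M_ν(x) := W_{-ν,1-ν}(-x)`. -/
noncomputable def mainardiM (ν x : ℝ) : ℝ := wright (-ν) (1 - ν) (-x)

/-- The Mainardi auxiliary function `F_ν(x) := W_{-ν,0}(-x)`. -/
noncomputable def mainardiF (ν x : ℝ) : ℝ := wright (-ν) 0 (-x)

/-- Euler's reflection formula for the reciprocal Gamma function, valid also at the poles of
`Γ (-s)`, where both sides vanish. -/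
theorem Real.inv_Gamma_neg {s : ℝ} (hs : 0 < s) :
    (Real.Gamma (-s))⁻¹ = -(Real.Gamma (1 + s) * Real.sin (π * s)) / π := by
  have h := Real.Gamma_mul_Gamma_one_sub (-s)
  rw [sub_neg_eq_add, mul_neg, Real.sin_neg] at h
  have hG : Real.Gamma (1 + s) ≠ 0 := (Real.Gamma_pos_of_pos (by linarith)).ne'
  rw [eq_div_of_mul_eq hG h, inv_div, div_div_eq_mul_div]
  ring

/-- The constant term of `F_ν` vanishes since `Γ` has a pole at `0`. -/
theorem mainardiF_eq_tsum_succ (ν x : ℝ) :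
    mainardiF ν x = ∑' n : ℕ, (-x) ^ (n + 1) /
      (((n + 1).factorial : ℝ) * Real.Gamma (-(ν * (n + 1)))) := by
  rw [mainardiF, wright, ← Nat.succ_injective.tsum_eq]
  · refine tsum_congr fun n => ?_
    simp only [Nat.succ_eq_add_one]
    push_cast
    rw [neg_mul, add_zero]
  · intro n hn
    rcases n with _ | n
    · simp [Real.Gamma_zero] at hn
    · exact ⟨n, rfl⟩

/-- The relation `F_ν(x) = ν x M_ν(x)` between the two Mainardi functions. -/
theorem mainardiF_eq_mul_mainardiM {ν : ℝ} (hν : ν ≠ 0) (x : ℝ) :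
    mainardiF ν x = ν * x * mainardiM ν x := by
  rw [mainardiF_eq_tsum_succ, mainardiM, wright, ← tsum_mul_left]
  refine tsum_congr fun n => ?_
  have hn : (n : ℝ) + 1 ≠ 0 := by positivity
  have h : Real.Gamma (-ν * n + (1 - ν)) = -(ν * (n + 1)) * Real.Gamma (-(ν * (n + 1))) := by
    rw [← Real.Gamma_add_one (neg_ne_zero.mpr (mul_ne_zero hν hn))]
    congr 1
    ring
  rw [h, Nat.factorial_succ]
  push_cast
  generalize Real.Gamma (-(ν * (n + 1))) = g
  rcases eq_or_ne g 0 with rfl | hg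
  · simp
  · field_simp
    ring

/-- The bilateral extremal Lévy stable density `L_α^{α-2}` expressed through the
Mainardi auxiliary functions, for `1 < α ≤ 2` and `x > 0`. -/
theorem extremal_stable_bilateral (α : ℝ) (hα1 : 1 < α) (hα2 : α ≤ 2)
    (x : ℝ) (hx : 0 < x) (L : ℝ)
    (hL : L = -(1 / (π * x)) * ∑' n : ℕ,
      (-x) ^ (n + 1) * Real.Gamma (1 + (n + 1) / α) *
        Real.sin ((n + 1) * π / α) / ((n + 1).factorial : ℝ)) :
    L = (1 / x) * mainardiF (1 / α) x ∧
    L = (1 / α) * mainardiM (1 / α) x := by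
  have hF : L = (1 / x) * mainardiF (1 / α) x := by
    rw [hL, mainardiF_eq_tsum_succ, ← tsum_mul_left, ← tsum_mul_left]
    refine tsum_congr fun n => ?_
    have hs : 0 < 1 / α * ((n : ℝ) + 1) := by positivity
    rw [div_mul_eq_div_div _ ((n + 1).factorial : ℝ), div_eq_mul_inv _ (Real.Gamma _),
      Real.inv_Gamma_neg hs, show 1 / α * ((n : ℝ) + 1) = (n + 1) / α by ring,
      show π * (((n : ℝ) + 1) / α) = (n + 1) * π / α by ring]
    field_simp
  refine ⟨hF, ?_⟩
  rw [hF, mainardiF_eq_mul_mainardiM (by positivity)]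
  field_simp
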